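/- Let x_* be a minimizer of F. Consider sequences {x_k}_{k≥−1} ⊂ ℝⁿ, {y_k}_{k≥1} ⊂ ℝⁿ, {t_k}_{k≥1}, {σ_k}_{k≥1} with σ_k > 0, and symmetric positive definite matrices {H_k}_{k≥1} satisfying: x_{−1} = x_0, y_1 = x_0, t_1 = 1, σ_1 = 1, H_1 = I; for every k ≥ 1, t_{k+1} = (1/2)(1 + √(1 + 4 (σ_k/σ_{k+1}) t_k²)), x_k = p_{H_k}(y_k) with F(x_k) ≤ Q_{H_k}(x_k, y_k), y_{k+1} = x_k + ((t_k − 1)/t_{k+1})(x_k − x_{k−1}), and σ_{k+1} H_{k+1} ⪯ σ_k H_k. If there exists σ̲ > 0 such that σ_k ≥ σ̲ for all k, then for every k ≥ 1, F(x_k) − F(x_*) ≤ 2‖x_0 − x_*‖² / (σ̲ k²). -/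

import Mathlib

open scoped RealInnerProductSpace
open Finset

/-- Matrix-vector product, viewed as an operation on Euclidean space. -/
noncomputable def mulVecE {n : ℕ} (H : Matrix (Fin n) (Fin n) ℝ)
    (w : EuclideanSpace ℝ (Fin n)) : EuclideanSpace ℝ (Fin n) :=
  (WithLp.equiv 2 (Fin n → ℝ)).symm (H.mulVec ((WithLp.equiv 2 (Fin n → ℝ)) w))

/-- The composite quadratic approximation
`Q_H(u,v) = f(v) + ⟨∇f(v), u−v⟩ + (1/2)⟨H(u−v), u−v⟩ + g(u)`. -/
noncomputable def Qa {n : ℕ} (f g : EuclideanSpace ℝ (Fin n) → ℝ)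
    (H : Matrix (Fin n) (Fin n) ℝ) (u v : EuclideanSpace ℝ (Fin n)) : ℝ :=
  f v + ⟪ gradient f v, u - v ⟫ + (1 / 2) * ⟪ mulVecE H (u - v), u - v ⟫ + g u

section

variable {n : ℕ}

lemma mulVecE_eq_toEuclideanLin (H : Matrix (Fin n) (Fin n) ℝ) (w : EuclideanSpace ℝ (Fin n)) :
    mulVecE H w = Matrix.toEuclideanLin H w := rfl

lemma inner_mulVecE_smul (H : Matrix (Fin n) (Fin n) ℝ) (c : ℝ) (w : EuclideanSpace ℝ (Fin n)) :
    ⟪mulVecE H (c • w), c • w⟫ = c ^ 2 * ⟪mulVecE H w, w⟫ := by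
  simp only [mulVecE_eq_toEuclideanLin, map_smul, real_inner_smul_left, real_inner_smul_right]
  ring

lemma inner_mulVecE_neg (H : Matrix (Fin n) (Fin n) ℝ) (w : EuclideanSpace ℝ (Fin n)) :
    ⟪mulVecE H (-w), -w⟫ = ⟪mulVecE H w, w⟫ := by
  simpa using inner_mulVecE_smul H (-1) w

lemma inner_mulVecE_one (w : EuclideanSpace ℝ (Fin n)) :
    ⟪mulVecE (1 : Matrix (Fin n) (Fin n) ℝ) w, w⟫ = ‖w‖ ^ 2 := by
  simp [mulVecE]

lemma inner_mulVecE_convexCombo (H : Matrix (Fin n) (Fin n) ℝ) (s : ℝ)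
    (a b : EuclideanSpace ℝ (Fin n)) :
    ⟪mulVecE H ((1 - s) • a + s • b), (1 - s) • a + s • b⟫ =
      (1 - s) * ⟪mulVecE H a, a⟫ + s * ⟪mulVecE H b, b⟫
        - s * (1 - s) * ⟪mulVecE H (b - a), b - a⟫ := by
  simp only [mulVecE_eq_toEuclideanLin, map_smul, map_add, map_sub, inner_add_left,
    inner_add_right, inner_sub_left, inner_sub_right, real_inner_smul_left, real_inner_smul_right]
  ring

lemma inner_mulVecE_le_of_posSemidef_sub {A B : Matrix (Fin n) (Fin n) ℝ} {a b : ℝ}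
    (h : (a • A - b • B).PosSemidef) (w : EuclideanSpace ℝ (Fin n)) :
    b * ⟪mulVecE B w, w⟫ ≤ a * ⟪mulVecE A w, w⟫ := by
  have h0 : 0 ≤ ⟪mulVecE (a • A - b • B) w, w⟫ := by
    simpa [mulVecE, EuclideanSpace.inner_eq_star_dotProduct] using
      h.dotProduct_mulVec_nonneg w.ofLp
  simp only [mulVecE_eq_toEuclideanLin, map_sub, map_smul, LinearMap.sub_apply,
    LinearMap.smul_apply, inner_sub_left, real_inner_smul_left] at h0 ⊢
  linarith

lemma ConvexOn.add_inner_gradient_le {E : Type*} [NormedAddCommGroup E] [InnerProductSpace ℝ E]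
    [CompleteSpace E] {f : E → ℝ} (hf : ConvexOn ℝ Set.univ f) {v : E}
    (hfd : DifferentiableAt ℝ f v) (u : E) :
    f v + ⟪gradient f v, u - v⟫ ≤ f u := by
  have hline : ConvexOn ℝ Set.univ (f ∘ AffineMap.lineMap (k := ℝ) v u) :=
    hf.comp_affineMap (AffineMap.lineMap v u)
  have hderiv : HasDerivAt (f ∘ AffineMap.lineMap (k := ℝ) v u) (fderiv ℝ f v (u - v)) 0 := by
    refine HasFDerivAt.comp_hasDerivAt (0 : ℝ) ?_ AffineMap.hasDerivAt_lineMap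
    simpa using hfd.hasFDerivAt
  have hslope := hline.le_slope_of_hasDerivAt (Set.mem_univ 0) (Set.mem_univ 1) one_pos hderiv
  rw [← inner_gradient_left] at hslope
  simp only [slope_def_field, Function.comp_apply, AffineMap.lineMap_apply_zero,
    AffineMap.lineMap_apply_one, sub_zero, div_one] at hslope
  linarith

/-- A minimizer of `Qa f g H · v` satisfies the quadratic growth inequality. -/
lemma Qa_add_half_inner_le {f g : EuclideanSpace ℝ (Fin n) → ℝ} (hg : ConvexOn ℝ Set.univ g)
    {H : Matrix (Fin n) (Fin n) ℝ} {p v : EuclideanSpace ℝ (Fin n)}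
    (hp : ∀ u, Qa f g H p v ≤ Qa f g H u v) (u : EuclideanSpace ℝ (Fin n)) :
    Qa f g H p v + 1 / 2 * ⟪mulVecE H (u - p), u - p⟫ ≤ Qa f g H u v := by
  set c := 1 / 2 * ⟪mulVecE H (u - p), u - p⟫ with hc
  have key : ∀ s : ℝ, 0 < s → s < 1 → (1 - s) * c ≤ Qa f g H u v - Qa f g H p v := by
    intro s hs0 hs1
    have hmin := hp ((1 - s) • p + s • u)
    have hgs := hg.2 (Set.mem_univ p) (Set.mem_univ u) (sub_nonneg.2 hs1.le) hs0.le
      (sub_add_cancel 1 s)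
    have hdiff : (1 - s) • p + s • u - v = (1 - s) • (p - v) + s • (u - v) := by module
    have hquad := inner_mulVecE_convexCombo H s (p - v) (u - v)
    rw [sub_sub_sub_cancel_right] at hquad
    simp only [smul_eq_mul] at hgs
    refine le_of_mul_le_mul_left ?_ hs0
    simp only [Qa, hdiff, hquad, inner_add_right, real_inner_smul_right] at hmin ⊢
    rw [hc]
    linarith
  by_contra! hlt
  have hD : 0 ≤ Qa f g H u v - Qa f g H p v := sub_nonneg.2 (hp u)
  set D := Qa f g H u v - Qa f g H p v with hDdef
  have hDc : D < c := by linarith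
  have hcpos : 0 < c := hD.trans_lt hDc
  have hk := key ((c - D) / (2 * c)) (by apply div_pos <;> linarith)
    (by rw [div_lt_one (by positivity)]; linarith)
  have heq : (1 - (c - D) / (2 * c)) * c = (c + D) / 2 := by field_simp; ring
  linarith

/-- Three-point inequality for a proximal quasi-Newton step satisfying sufficient decrease. -/
lemma prox_step_three_point {f g : EuclideanSpace ℝ (Fin n) → ℝ} (hf : ConvexOn ℝ Set.univ f)
    (hfd : Differentiable ℝ f) (hg : ConvexOn ℝ Set.univ g)
    {H : Matrix (Fin n) (Fin n) ℝ} {p v : EuclideanSpace ℝ (Fin n)}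
    (hp : ∀ u, Qa f g H p v ≤ Qa f g H u v) (hdec : f p + g p ≤ Qa f g H p v)
    (u : EuclideanSpace ℝ (Fin n)) :
    f p + g p - (f u + g u) ≤
      1 / 2 * ⟪mulVecE H (u - v), u - v⟫ - 1 / 2 * ⟪mulVecE H (u - p), u - p⟫ := by
  have h1 := Qa_add_half_inner_le hg hp u
  have h2 := hf.add_inner_gradient_le (hfd v) u
  have h3 : Qa f g H u v =
    f v + ⟪gradient f v, u - v⟫ + 1 / 2 * ⟪mulVecE H (u - v), u - v⟫ + g u := rfl
  linarith

/-- One accelerated step, with the extrapolated point `y` written through `t • y`. -/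
lemma accelerated_prox_step {f g : EuclideanSpace ℝ (Fin n) → ℝ} (hf : ConvexOn ℝ Set.univ f)
    (hfd : Differentiable ℝ f) (hg : ConvexOn ℝ Set.univ g)
    {H : Matrix (Fin n) (Fin n) ℝ} {p v a xs w : EuclideanSpace ℝ (Fin n)}
    (hp : ∀ u, Qa f g H p v ≤ Qa f g H u v) (hdec : f p + g p ≤ Qa f g H p v)
    {t : ℝ} (ht : 1 ≤ t) (hv : t • v = (t - 1) • a + xs + w) :
    t ^ 2 * (f p + g p - (f xs + g xs)) + 1 / 2 *
        ⟪mulVecE H (t • p - (t - 1) • a - xs), t • p - (t - 1) • a - xs⟫ ≤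
      t * (t - 1) * (f a + g a - (f xs + g xs)) + 1 / 2 * ⟪mulVecE H w, w⟫ := by
  have ht0 : 0 < t := one_pos.trans_le ht
  set u := (1 - 1 / t) • a + (1 / t) • xs with hu
  have htu : t • u = (t - 1) • a + xs := by
    rw [hu, smul_add, smul_smul, smul_smul, mul_sub, mul_one_div_cancel ht0.ne', mul_one, one_smul]
  have hF := (hf.add hg).2 (Set.mem_univ a) (Set.mem_univ xs)
    (sub_nonneg.2 ((div_le_one ht0).2 ht)) (by positivity) (sub_add_cancel 1 (1 / t))
  simp only [Pi.add_apply, smul_eq_mul, ← hu] at hF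
  have hF' := mul_le_mul_of_nonneg_left hF (sq_nonneg t)
  have hE : t ^ 2 * ((1 - 1 / t) * (f a + g a) + 1 / t * (f xs + g xs)) =
      t * (t - 1) * (f a + g a) + t * (f xs + g xs) := by field_simp
  have h3 := mul_le_mul_of_nonneg_left (prox_step_three_point hf hfd hg hp hdec u) (sq_nonneg t)
  have hq1 : ⟪mulVecE H w, w⟫ = t ^ 2 * ⟪mulVecE H (u - v), u - v⟫ := by
    rw [← inner_mulVecE_smul, smul_sub, htu, hv, ← inner_mulVecE_neg]
    congr 2 <;> abel_nf
  have hq2 : ⟪mulVecE H (t • p - (t - 1) • a - xs), t • p - (t - 1) • a - xs⟫ =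
      t ^ 2 * ⟪mulVecE H (u - p), u - p⟫ := by
    have hneg : t • p - (t - 1) • a - xs = -(t • (u - p)) := by rw [smul_sub, htu]; abel
    rw [hneg, inner_mulVecE_neg, inner_mulVecE_smul]
  rw [hq1, hq2]
  linarith

/-- The positive root `T` of `T (T - 1) = r s ^ 2`. -/
lemma stepsize_root {r s T : ℝ} (hr : 0 ≤ r)
    (hT : T = 1 / 2 * (1 + √(1 + 4 * r * s ^ 2))) :
    1 ≤ T ∧ T * (T - 1) = r * s ^ 2 := by
  have hnn : 0 ≤ 4 * r * s ^ 2 := by positivity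
  have hsq := Real.sq_sqrt (show 0 ≤ 1 + 4 * r * s ^ 2 by linarith)
  have h1 : 1 ≤ √(1 + 4 * r * s ^ 2) := Real.one_le_sqrt.2 (by linarith)
  constructor
  · linarith
  · rw [hT]; linarith

end

theorem stmt15 {n : ℕ} (f g : EuclideanSpace ℝ (Fin n) → ℝ)
    (hf : ConvexOn ℝ Set.univ f) (hfd : Differentiable ℝ f)
    (L : ℝ) (hL : 0 < L)
    (hflip : ∀ x y, ‖gradient f x - gradient f y‖ ≤ L * ‖x - y‖)
    (hg : ConvexOn ℝ Set.univ g) (hgc : Continuous g)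
    (xs : EuclideanSpace ℝ (Fin n)) (hxs : ∀ z, f xs + g xs ≤ f z + g z)
    (x y : ℕ → EuclideanSpace ℝ (Fin n)) (t σ : ℕ → ℝ)
    (H : ℕ → Matrix (Fin n) (Fin n) ℝ)
    (hHpd : ∀ k, 1 ≤ k → (H k).PosDef)
    (hσpos : ∀ k, 1 ≤ k → 0 < σ k)
    (hy1 : y 1 = x 0) (ht1 : t 1 = 1) (hσ1 : σ 1 = 1)
    (hH1 : H 1 = (1 : Matrix (Fin n) (Fin n) ℝ))
    (htrec : ∀ k, 1 ≤ k →
      t (k + 1) = (1 / 2) * (1 + Real.sqrt (1 + 4 * (σ k / σ (k + 1)) * t k ^ 2)))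
    (hmin : ∀ k, 1 ≤ k → ∀ u, Qa f g (H k) (x k) (y k) ≤ Qa f g (H k) u (y k))
    (hdec : ∀ k, 1 ≤ k → f (x k) + g (x k) ≤ Qa f g (H k) (x k) (y k))
    (hyrec : ∀ k, 1 ≤ k →
      y (k + 1) = x k + ((t k - 1) / t (k + 1)) • (x k - x (k - 1)))
    (hLoew : ∀ k, 1 ≤ k → (σ k • H k - σ (k + 1) • H (k + 1)).PosSemidef)
    (σlb : ℝ) (hσlb : 0 < σlb) (hlb : ∀ k, 1 ≤ k → σlb ≤ σ k) :
    ∀ k : ℕ, 1 ≤ k →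
      (f (x k) + g (x k)) - (f xs + g xs) ≤ 2 * ‖x 0 - xs‖ ^ 2 / (σlb * (k : ℝ) ^ 2) := by
  have hroot : ∀ k, 1 ≤ k → 1 ≤ t (k + 1) ∧
      t (k + 1) * (t (k + 1) - 1) = σ k / σ (k + 1) * t k ^ 2 := fun k hk =>
    stepsize_root (div_pos (hσpos k hk) (hσpos (k + 1) (by omega))).le (htrec k hk)
  have hpotential : ∀ k, 1 ≤ k →
      σ k * t k ^ 2 * (f (x k) + g (x k) - (f xs + g xs)) + 1 / 2 * (σ k *
        ⟪mulVecE (H k) (t k • x k - (t k - 1) • x (k - 1) - xs),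
          t k • x k - (t k - 1) • x (k - 1) - xs⟫) ≤ 1 / 2 * ‖x 0 - xs‖ ^ 2 := by
    intro k hk
    induction k, hk using Nat.le_induction with
    | base =>
      have h := accelerated_prox_step (a := x 0) (xs := xs) (w := x 0 - xs) hf hfd hg
        (hmin 1 le_rfl) (hdec 1 le_rfl) (le_refl (1 : ℝ)) (by simp [hy1])
      rw [hH1, inner_mulVecE_one (x 0 - xs)] at h
      simpa [hσ1, ht1, hH1] using h
    | succ k hk ih =>
      obtain ⟨ht, hmul⟩ := hroot k hk
      have hσ := hσpos (k + 1) (by omega)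
      have hy : t (k + 1) • y (k + 1) =
          (t (k + 1) - 1) • x k + xs + (t k • x k - (t k - 1) • x (k - 1) - xs) := by
        rw [hyrec k hk, smul_add, smul_smul, mul_div_cancel₀ _ (by linarith)]
        module
      have h := accelerated_prox_step (xs := xs) hf hfd hg (hmin (k + 1) (by omega))
        (hdec (k + 1) (by omega)) ht hy
      have hmono := inner_mulVecE_le_of_posSemidef_sub (hLoew k hk)
        (t k • x k - (t k - 1) • x (k - 1) - xs)
      have h' := mul_le_mul_of_nonneg_left h hσ.le
      have hcoef : σ (k + 1) * (t (k + 1) * (t (k + 1) - 1)) *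
          (f (x k) + g (x k) - (f xs + g xs)) =
            σ k * t k ^ 2 * (f (x k) + g (x k) - (f xs + g xs)) := by
        rw [hmul]; field_simp
      rw [Nat.add_sub_cancel]
      linarith
  have hgrowth : ∀ k, 1 ≤ k → 0 < t k ∧ √σlb * ((k : ℝ) + 1) / 2 ≤ √(σ k) * t k := by
    intro k hk
    induction k, hk using Nat.le_induction with
    | base =>
      have := Real.sqrt_le_sqrt (hlb 1 le_rfl)
      rw [ht1]
      norm_num
      linarith
    | succ k hk ih =>
      obtain ⟨ht, hmul⟩ := hroot k hk
      have hσ := hσpos (k + 1) (by omega)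
      refine ⟨by linarith, ?_⟩
      have hs := Real.sqrt_le_sqrt (hlb (k + 1) (by omega))
      have hsq := Real.sq_sqrt hσ.le
      have hsq' := Real.sq_sqrt (hσpos k hk).le
      have hpos := Real.sqrt_pos.2 hσ
      have hcoef : σ (k + 1) * (t (k + 1) * (t (k + 1) - 1)) = σ k * t k ^ 2 := by
        rw [hmul]; field_simp
      have hhalf : √(σ k) * t k ≤ √(σ (k + 1)) * (t (k + 1) - 1 / 2) := by
        refine abs_le_of_sq_le_sq' ?_ (mul_nonneg hpos.le (by linarith)) |>.2
        rw [mul_pow, mul_pow, hsq, hsq']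
        nlinarith
      push_cast
      linarith [ih.2]
  intro k hk
  have hkpos : (0 : ℝ) < k := by exact_mod_cast hk
  have hgap : 0 ≤ f (x k) + g (x k) - (f xs + g xs) := sub_nonneg.2 (hxs _)
  have hquad : 0 ≤ σ k * ⟪mulVecE (H k) (t k • x k - (t k - 1) • x (k - 1) - xs),
      t k • x k - (t k - 1) • x (k - 1) - xs⟫ := by
    simpa using inner_mulVecE_le_of_posSemidef_sub (A := H k) (B := 0) (a := σ k) (b := 0)
      (by simpa using (hHpd k hk).posSemidef.smul (hσpos k hk).le) _
  have hcoef : σlb * (k : ℝ) ^ 2 / 4 ≤ σ k * t k ^ 2 := by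
    have hle : √σlb * (k : ℝ) / 2 ≤ √(σ k) * t k := by
      linarith [(hgrowth k hk).2, Real.sqrt_nonneg σlb]
    have hsq := pow_le_pow_left₀ (by positivity) hle 2
    rw [div_pow, mul_pow, mul_pow, Real.sq_sqrt hσlb.le, Real.sq_sqrt (hσpos k hk).le] at hsq
    linarith
  rw [le_div_iff₀ (by positivity)]
  linarith [hpotential k hk, mul_le_mul_of_nonneg_right hcoef hgap]
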